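/- There exist a gentle algebra A of rank 2 and an almost-tilting A-module M (i.e. an indecomposable pre-tilting module) such that M has exactly 3 isomorphism classes of complements, i.e. exactly 3 isomorphism classes of indecomposable A-modules N with N ∉ add M and M ⊕ N a tilting module; in particular the bound 2n − 1 is attained for n = 2. -/

import Mathlib

open CategoryTheory

universe u

/-- The combinatorial data of a gentle presentation: a finite quiver together with a
set of relations given by composable paths of length two, satisfying the gentle
conditions. -/
structure GentleQuiverData : Type (u + 1) where
  /-- vertices -/
  V : Type u
  /-- arrows -/
  E : Type u
  fintV : Fintype V
  fintE : Fintype E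
  /-- source -/
  src : E → V
  /-- target -/
  tgt : E → V
  /-- `rel a b` means that the length-two path `ab` is one of the generating relations -/
  rel : E → E → Prop
  rel_comp : ∀ a b, rel a b → tgt a = src b
  src_le_two : ∀ v : V, Set.ncard {a : E | src a = v} ≤ 2
  tgt_le_two : ∀ v : V, Set.ncard {a : E | tgt a = v} ≤ 2
  rel_right_unique : ∀ a b c, rel a b → rel a c → b = c
  rel_left_unique : ∀ a b c, rel b a → rel c a → b = c
  nonrel_right_unique : ∀ a b c, tgt a = src b → ¬ rel a b → tgt a = src c → ¬ rel a c → b = c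
  nonrel_left_unique : ∀ a b c, tgt b = src a → ¬ rel b a → tgt c = src a → ¬ rel c a → b = c

attribute [instance] GentleQuiverData.fintV GentleQuiverData.fintE

/-- The quiver is connected. -/
def GentleQuiverData.Connected (Q : GentleQuiverData.{u}) : Prop :=
  ∀ v w : Q.V, Relation.ReflTransGen
    (fun x y => ∃ a : Q.E, (Q.src a = x ∧ Q.tgt a = y) ∨ (Q.src a = y ∧ Q.tgt a = x)) v w

variable (k : Type u) [Field k]

/-- The relations presenting the gentle algebra `kQ/I` as a quotient of the free algebra
on vertices and arrows: the vertices are orthogonal idempotents summing to `1`, arrows are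
compatible with sources and targets, and the chosen length-two paths vanish. -/
inductive GentleRel (Q : GentleQuiverData.{u}) :
    FreeAlgebra k (Q.V ⊕ Q.E) → FreeAlgebra k (Q.V ⊕ Q.E) → Prop
  | idem (v : Q.V) :
      GentleRel Q (FreeAlgebra.ι k (Sum.inl v) * FreeAlgebra.ι k (Sum.inl v))
        (FreeAlgebra.ι k (Sum.inl v))
  | orth (v w : Q.V) : v ≠ w →
      GentleRel Q (FreeAlgebra.ι k (Sum.inl v) * FreeAlgebra.ι k (Sum.inl w)) 0
  | sum_idem :
      GentleRel Q (∑ v : Q.V, FreeAlgebra.ι k (Sum.inl v)) 1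
  | src_mul (a : Q.E) :
      GentleRel Q (FreeAlgebra.ι k (Sum.inl (Q.src a)) * FreeAlgebra.ι k (Sum.inr a))
        (FreeAlgebra.ι k (Sum.inr a))
  | mul_tgt (a : Q.E) :
      GentleRel Q (FreeAlgebra.ι k (Sum.inr a) * FreeAlgebra.ι k (Sum.inl (Q.tgt a)))
        (FreeAlgebra.ι k (Sum.inr a))
  | relation (a b : Q.E) : Q.rel a b →
      GentleRel Q (FreeAlgebra.ι k (Sum.inr a) * FreeAlgebra.ι k (Sum.inr b)) 0

/-- The gentle algebra `kQ/I` associated to gentle quiver data. -/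
abbrev GentleAlg (Q : GentleQuiverData.{u}) : Type u := RingQuot (GentleRel k Q)

section Modules

variable {B : Type u} [Ring B]

/-- `X` belongs to `add T`: it is a direct summand of a finite direct sum of copies of `T`. -/
def MemAdd (T X : ModuleCat.{u} B) : Prop :=
  ∃ (n : ℕ) (f : X →ₗ[B] (Fin n → T)) (g : (Fin n → T) →ₗ[B] X), g.comp f = LinearMap.id

/-- An indecomposable module: nonzero, and any direct sum decomposition is trivial. -/
def IsIndec (X : ModuleCat.{u} B) : Prop :=
  Nontrivial X ∧ ∀ Y Z : ModuleCat.{u} B,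
    Nonempty (X ≃ₗ[B] Y × Z) → Subsingleton Y ∨ Subsingleton Z

/-- `M` decomposes as the direct sum of the family `N` of pairwise non-isomorphic
indecomposable modules; in particular `M` is multiplicity-free. -/
def IsIndecDecomp (M : ModuleCat.{u} B) {m : ℕ} (N : Fin m → ModuleCat.{u} B) : Prop :=
  (∀ i, IsIndec (N i)) ∧
  (∀ i j, i ≠ j → IsEmpty (N i ≃ₗ[B] N j)) ∧
  Nonempty (M ≃ₗ[B] ((i : Fin m) → N i))

/-- `M` is multiplicity-free with exactly `m` pairwise non-isomorphic indecomposable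
direct summands. -/
def HasRank (M : ModuleCat.{u} B) (m : ℕ) : Prop :=
  ∃ N : Fin m → ModuleCat.{u} B, IsIndecDecomp M N

/-- Projective dimension at most `d`held via an explicit projective resolution. -/
def ProjDimLE : ModuleCat.{u} B → ℕ → Prop
  | X, 0 => Module.Projective B X
  | X, (d + 1) => ∃ P : ModuleCat.{u} B, Module.Projective B P ∧
      ∃ f : P →ₗ[B] X, Function.Surjective f ∧ ProjDimLE (ModuleCat.of B (LinearMap.ker f)) d

/-- (T1): finite projective dimension. -/
def HasFiniteProjDim (X : ModuleCat.{u} B) : Prop := ∃ d, ProjDimLE X d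

/-- There is an exact sequence `0 → X → T₀ → ⋯ → T_d → 0` with all `Tᵢ` in `add T`. -/
def CoresolvedBy (T : ModuleCat.{u} B) : ModuleCat.{u} B → ℕ → Prop
  | X, 0 => MemAdd T X
  | X, (d + 1) => ∃ T₀ : ModuleCat.{u} B, MemAdd T T₀ ∧
      ∃ f : X →ₗ[B] T₀, Function.Injective f ∧
        CoresolvedBy T (ModuleCat.of B (T₀ ⧸ LinearMap.range f)) d

/-- The Ext-group `Ext^n_B(X, Y)`. -/
noncomputable def ExtGroup (X Y : ModuleCat.{u} B) (n : ℕ) : Type (u + 1) :=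
  letI : HasDerivedCategory.{u + 1} (ModuleCat.{u} B) := HasDerivedCategory.standard _
  letI : HasExt.{u + 1} (ModuleCat.{u} B) := hasExt_of_hasDerivedCategory _
  Abelian.Ext X Y n

/-- (T2): `Ext^i(T, T) = 0` for all `i > 0`. -/
def SelfOrthogonal (T : ModuleCat.{u} B) : Prop :=
  ∀ i : ℕ, 0 < i → Subsingleton (ExtGroup T T i)

/-- Pre-tilting: (T1) and (T2). -/
def IsPreTilting (T : ModuleCat.{u} B) : Prop :=
  HasFiniteProjDim T ∧ SelfOrthogonal T

/-- Tilting: (T1), (T2) and (T3) (an `add T`-coresolution of the regular module). -/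
def IsTilting (T : ModuleCat.{u} B) : Prop :=
  HasFiniteProjDim T ∧ SelfOrthogonal T ∧ ∃ d, CoresolvedBy T (ModuleCat.of B B) d

/-- The direct sum `M ⊕ N`. -/
def dSum (M N : ModuleCat.{u} B) : ModuleCat.{u} B := ModuleCat.of B (M × N)

/-- `N` is an (indecomposable) complement to `M`: a finite-dimensional indecomposable module
not in `add M` such that `M ⊕ N` is a tilting module. -/
def IsComplement (M N : ModuleCat.{u} B) : Prop :=
  Module.Finite B N ∧ IsIndec N ∧ ¬ MemAdd M N ∧ IsTilting (dSum M N)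

end Modules

section Homological

variable {B : Type u} [Ring B]

/-- Projective dimension is computed by any short exact sequence with projective middle term. -/
theorem ProjDimLE.of_exact {K P X : Type u} [AddCommGroup K] [AddCommGroup P] [AddCommGroup X]
    [Module B K] [Module B P] [Module B X] (hP : Module.Projective B P)
    (i : K →ₗ[B] P) (p : P →ₗ[B] X) (hi : Function.Injective i) (hp : Function.Surjective p)
    (hip : Function.Exact i p) {d : ℕ}
    (hK : ∀ K' : ModuleCat.{u} B, Nonempty (K ≃ₗ[B] K') → ProjDimLE K' d)
    (X' : ModuleCat.{u} B) (e : Nonempty (X ≃ₗ[B] X')) : ProjDimLE X' (d + 1) := by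
  obtain ⟨e⟩ := e
  refine ⟨ModuleCat.of B P, hP, e.toLinearMap.comp p, e.surjective.comp hp, hK _ ⟨?_⟩⟩
  refine (LinearEquiv.ofInjective i hi).trans (LinearEquiv.ofEq _ _ ?_)
  rw [LinearEquiv.ker_comp]
  exact (LinearMap.exact_iff.mp hip).symm

theorem ProjDimLE.of_projective {K : Type u} [AddCommGroup K] [Module B K]
    (hK : Module.Projective B K) (K' : ModuleCat.{u} B) (e : Nonempty (K ≃ₗ[B] K')) :
    ProjDimLE K' 0 :=
  Module.Projective.of_equiv e.some

theorem MemAdd.of_retract {T X : ModuleCat.{u} B} (f : X →ₗ[B] T) (g : T →ₗ[B] X)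
    (h : ∀ x, g (f x) = x) : MemAdd T X :=
  ⟨1, LinearMap.pi fun _ => f, g.comp (LinearMap.proj 0), LinearMap.ext fun x => h x⟩

theorem MemAdd.prod {T X Y : ModuleCat.{u} B} (hX : MemAdd T X) (hY : MemAdd T Y) :
    MemAdd T (ModuleCat.of B (X × Y)) := by
  obtain ⟨m, f, g, hfg⟩ := hX
  obtain ⟨n, f', g', hfg'⟩ := hY
  let e : (Fin m ⊕ Fin n → T) ≃ₗ[B] (Fin (m + n) → T) :=
    LinearEquiv.funCongrLeft B T finSumFinEquiv.symm
  let s : ((Fin m → T) × (Fin n → T)) ≃ₗ[B] (Fin m ⊕ Fin n → T) :=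
    (LinearEquiv.sumArrowLequivProdArrow (Fin m) (Fin n) B T).symm
  refine ⟨m + n, (s.trans e).toLinearMap.comp (f.prodMap f'),
    (g.prodMap g').comp (s.trans e).symm.toLinearMap, LinearMap.ext fun x => ?_⟩
  have h1 := LinearMap.congr_fun hfg x.1
  have h2 := LinearMap.congr_fun hfg' x.2
  simp only [LinearMap.comp_apply, LinearEquiv.coe_coe, LinearEquiv.symm_apply_apply,
    LinearMap.id_apply] at h1 h2 ⊢
  exact Prod.ext h1 h2

theorem MemAdd.of_equiv {T X Y : ModuleCat.{u} B} (hX : MemAdd T X) (e : X ≃ₗ[B] Y) :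
    MemAdd T Y := by
  obtain ⟨n, f, g, h⟩ := hX
  refine ⟨n, f.comp e.symm.toLinearMap, e.toLinearMap.comp g, LinearMap.ext fun y => ?_⟩
  have := LinearMap.congr_fun h (e.symm y)
  simp only [LinearMap.comp_apply, LinearMap.id_apply, LinearEquiv.coe_coe] at this ⊢
  rw [this, e.apply_symm_apply]

/-- Coresolutions can be built from arbitrary short exact sequences. -/
theorem CoresolvedBy.of_exact {T : ModuleCat.{u} B} {X T₀ C : Type u}
    [AddCommGroup X] [AddCommGroup T₀] [AddCommGroup C] [Module B X] [Module B T₀] [Module B C]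
    (hT : MemAdd T (ModuleCat.of B T₀)) (i : X →ₗ[B] T₀) (p : T₀ →ₗ[B] C)
    (hi : Function.Injective i) (hp : Function.Surjective p) (hip : Function.Exact i p) {d : ℕ}
    (hC : ∀ C' : ModuleCat.{u} B, Nonempty (C ≃ₗ[B] C') → CoresolvedBy T C' d)
    (X' : ModuleCat.{u} B) (e : Nonempty (X ≃ₗ[B] X')) : CoresolvedBy T X' (d + 1) := by
  obtain ⟨e⟩ := e
  refine ⟨ModuleCat.of B T₀, hT, i.comp e.symm.toLinearMap, hi.comp e.symm.injective, hC _ ⟨?_⟩⟩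
  refine (p.quotKerEquivOfSurjective hp).symm.trans (Submodule.quotEquivOfEq _ _ ?_)
  rw [LinearEquiv.range_comp]
  exact LinearMap.exact_iff.mp hip

theorem CoresolvedBy.of_memAdd {T : ModuleCat.{u} B} {X : Type u}
    [AddCommGroup X] [Module B X] (hX : MemAdd T (ModuleCat.of B X))
    (X' : ModuleCat.{u} B) (e : Nonempty (X ≃ₗ[B] X')) : CoresolvedBy T X' 0 :=
  hX.of_equiv (X := ModuleCat.of B X) e.some

theorem SelfOrthogonal.of_projective (T : ModuleCat.{u} B) (h : Module.Projective B T) :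
    SelfOrthogonal T := by
  intro i hi
  obtain ⟨n, rfl⟩ := Nat.exists_eq_succ_of_ne_zero hi.ne'
  let : HasDerivedCategory.{u + 1} (ModuleCat.{u} B) := HasDerivedCategory.standard _
  let : HasExt.{u + 1} (ModuleCat.{u} B) := hasExt_of_hasDerivedCategory _
  have : Projective T := (IsProjective.iff_projective T).mp h
  exact Abelian.Ext.subsingleton_of_projective T T n

theorem SelfOrthogonal.of_injective (T : ModuleCat.{u} B) (h : Module.Injective B T) :
    SelfOrthogonal T := by
  intro i hi
  obtain ⟨n, rfl⟩ := Nat.exists_eq_succ_of_ne_zero hi.ne'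
  let : HasDerivedCategory.{u + 1} (ModuleCat.{u} B) := HasDerivedCategory.standard _
  let : HasExt.{u + 1} (ModuleCat.{u} B) := hasExt_of_hasDerivedCategory _
  have : Injective T := Module.injective_object_of_injective_module B T
  exact Abelian.Ext.subsingleton_of_injective T T n

/-- A module of projective dimension at most one is self-orthogonal as soon as every map from its
first syzygy to it extends to the projective cover. -/
theorem SelfOrthogonal.of_exact {K P T : ModuleCat.{u} B} (hK : Module.Projective B K)
    (hP : Module.Projective B P) (i : K →ₗ[B] P) (p : P →ₗ[B] T) (hi : Function.Injective i)
    (hp : Function.Surjective p) (hip : Function.Exact i p)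
    (hext : ∀ f : K →ₗ[B] T, ∃ g : P →ₗ[B] T, g.comp i = f) : SelfOrthogonal T := by
  intro n hn
  let : HasDerivedCategory.{u + 1} (ModuleCat.{u} B) := HasDerivedCategory.standard _
  let : HasExt.{u + 1} (ModuleCat.{u} B) := hasExt_of_hasDerivedCategory _
  have : Projective K := (IsProjective.iff_projective K).mp hK
  have : Projective P := (IsProjective.iff_projective P).mp hP
  let S : ShortComplex (ModuleCat.{u} B) :=
    ShortComplex.mk (ModuleCat.ofHom i) (ModuleCat.ofHom p)
      (ModuleCat.hom_ext (LinearMap.ext fun x => hip.apply_apply_eq_zero x))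
  have hS : S.ShortExact :=
    { exact := (ShortComplex.ShortExact.moduleCat_exact_iff_function_exact S).mpr hip
      mono_f := (ModuleCat.mono_iff_injective _).mpr hi
      epi_g := (ModuleCat.epi_iff_surjective _).mpr hp }
  obtain ⟨m, rfl⟩ := Nat.exists_eq_succ_of_ne_zero hn.ne'
  refine subsingleton_of_forall_eq (0 : Abelian.Ext T T (m + 1)) fun x => ?_
  obtain ⟨y, hy⟩ := Abelian.Ext.contravariant_sequence_exact₃ hS T x
    (@Abelian.Ext.eq_zero_of_projective _ _ _ _ P T m _ _) (Nat.add_comm 1 m)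
  rw [← hy]
  cases m with
  | succ m =>
    rw [show y = 0 from @Abelian.Ext.eq_zero_of_projective _ _ _ _ K T m _ y, Abelian.Ext.comp_zero]
  | zero =>
    obtain ⟨g, hg⟩ := hext (Abelian.Ext.homEquiv₀ y).hom
    have hy' : y = (Abelian.Ext.mk₀ S.f).comp (Abelian.Ext.mk₀ (ModuleCat.ofHom g)) (add_zero 0) := by
      rw [Abelian.Ext.mk₀_comp_mk₀, ← Abelian.Ext.mk₀_homEquiv₀_apply y]
      congr 1
      exact ModuleCat.hom_ext hg.symm
    rw [hy']
    exact hS.extClass_comp_assoc _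

theorem Module.Injective.prod {X Y : Type u} [AddCommGroup X] [AddCommGroup Y] [Module B X]
    [Module B Y] (hX : Module.Injective B X) (hY : Module.Injective B Y) :
    Module.Injective B (X × Y) where
  out _ _ _ _ _ _ f hf g := by
    obtain ⟨h₁, hh₁⟩ := hX.out f hf ((LinearMap.fst B X Y).comp g)
    obtain ⟨h₂, hh₂⟩ := hY.out f hf ((LinearMap.snd B X Y).comp g)
    exact ⟨h₁.prod h₂, fun x => Prod.ext (hh₁ x) (hh₂ x)⟩

/-- A module in which some fixed nonzero element is a multiple of every nonzero element is
indecomposable. -/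
theorem IsIndec.of_essential_element {X : ModuleCat.{u} B} (s : X) (hs : s ≠ 0)
    (h : ∀ x : X, x ≠ 0 → ∃ c : B, c • x = s) : IsIndec X := by
  refine ⟨⟨s, 0, hs⟩, fun Y Z ⟨e⟩ => ?_⟩
  by_contra! hYZ
  obtain ⟨hY, hZ⟩ := hYZ
  obtain ⟨y, hy⟩ := exists_ne (0 : Y)
  obtain ⟨z, hz⟩ := exists_ne (0 : Z)
  obtain ⟨c, hc⟩ := h (e.symm (y, 0)) (by simpa using hy)
  obtain ⟨d, hd⟩ := h (e.symm (0, z)) (by simpa using hz)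
  have h1 : c • ((y, 0) : Y × Z) = d • ((0, z) : Y × Z) := by
    apply e.symm.injective
    rw [map_smul, map_smul, hc, hd]
  have h2 : c • ((y, 0) : Y × Z) = 0 := by
    refine Prod.ext ?_ ?_
    · simpa using congrArg Prod.fst h1
    · simp
  apply hs
  rw [← hc, ← map_smul, h2, map_zero]

/-- A nonzero retract of an indecomposable module is isomorphic to it. -/
theorem IsIndec.nonempty_equiv_of_retract {X N : ModuleCat.{u} B} (hX : IsIndec X) [Nontrivial N]
    (s : N →ₗ[B] X) (r : X →ₗ[B] N) (h : ∀ v, r (s v) = v) : Nonempty (X ≃ₗ[B] N) := by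
  let e : X →ₗ[B] N × LinearMap.ker r :=
    r.prod ((LinearMap.id - s.comp r).codRestrict _ fun x => by simp [h])
  have he : Function.Bijective e := by
    constructor
    · refine (injective_iff_map_eq_zero e).mpr fun x hx => ?_
      have h1 : r x = 0 := congrArg Prod.fst hx
      have h2 : x - s (r x) = 0 := congrArg (fun z => (z.2 : X)) hx
      simpa [h1] using h2
    · rintro ⟨v, w, hw⟩
      have hw' : r w = 0 := hw
      refine ⟨s v + w, Prod.ext ?_ (Subtype.ext ?_)⟩
      · change r (s v + w) = v
        simp [h, hw']
      · change s v + w - s (r (s v + w)) = w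
        simp [h, hw']
  rcases hX.2 N (ModuleCat.of B (LinearMap.ker r)) ⟨LinearEquiv.ofBijective e he⟩ with hN | hK
  · exact absurd hN (not_subsingleton N)
  · refine ⟨LinearEquiv.ofBijective r ⟨?_, fun v => ⟨s v, h v⟩⟩⟩
    exact LinearMap.ker_eq_bot.mp ((Submodule.subsingleton_iff_eq_bot).mp hK)

end Homological

section Algebra

/-- The quiver with two vertices and one arrow in each direction, in which the composite
`0 → 1 → 0` is zero. Vertices are Booleans, and the arrow named `v` starts at `v`. -/
abbrev twoCycle : GentleQuiverData.{u} where
  V := ULift.{u} Bool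
  E := ULift.{u} Bool
  fintV := inferInstance
  fintE := inferInstance
  src v := v
  tgt v := ⟨!v.down⟩
  rel x y := x = ⟨false⟩ ∧ y = ⟨true⟩
  rel_comp := by rintro _ _ ⟨rfl, rfl⟩; rfl
  src_le_two v := (Set.ncard_le_card _).trans (by simp)
  tgt_le_two v := (Set.ncard_le_card _).trans (by simp)
  rel_right_unique := by rintro _ _ _ ⟨rfl, rfl⟩ ⟨_, rfl⟩; rfl
  rel_left_unique := by rintro _ _ _ ⟨rfl, rfl⟩ ⟨rfl, _⟩; rfl
  nonrel_right_unique := by rintro a b c rfl _ rfl _; rfl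
  nonrel_left_unique := by
    rintro ⟨a⟩ ⟨b⟩ ⟨c⟩ h _ h' _
    have h1 : (!b) = a := congrArg ULift.down h
    have h2 : (!c) = a := congrArg ULift.down h'
    rw [← h2, Bool.not_inj_iff] at h1
    rw [h1]

/-- The opposite of the gentle algebra of `twoCycle`: its left modules are the right modules
over the gentle algebra. -/
abbrev TwoCycleOp : Type u := (GentleAlg k twoCycle.{u})ᵐᵒᵖ

namespace TwoCycleOp

/-- A generator of the algebra. -/
noncomputable def gen (x : ULift.{u} Bool ⊕ ULift.{u} Bool) : TwoCycleOp k :=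
  MulOpposite.op (RingQuot.mkAlgHom k (GentleRel k twoCycle.{u}) (FreeAlgebra.ι k x))

/-- The idempotent at the first vertex. -/
noncomputable def e₁ : TwoCycleOp k := gen k (Sum.inl ⟨false⟩)

/-- The idempotent at the second vertex. -/
noncomputable def e₂ : TwoCycleOp k := gen k (Sum.inl ⟨true⟩)

/-- The arrow from the first to the second vertex. -/
noncomputable def a : TwoCycleOp k := gen k (Sum.inr ⟨false⟩)

/-- The arrow from the second to the first vertex. -/
noncomputable def b : TwoCycleOp k := gen k (Sum.inr ⟨true⟩)

variable {k}

theorem gen_mul_gen (x y : ULift.{u} Bool ⊕ ULift.{u} Bool) :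
    gen k x * gen k y = MulOpposite.op (RingQuot.mkAlgHom k (GentleRel k twoCycle.{u})
      (FreeAlgebra.ι k y * FreeAlgebra.ι k x)) := by
  rw [gen, gen, ← MulOpposite.op_mul, map_mul]

theorem gen_mul_gen_of_rel {x y z : ULift.{u} Bool ⊕ ULift.{u} Bool}
    (h : GentleRel k twoCycle.{u} (FreeAlgebra.ι k y * FreeAlgebra.ι k x) (FreeAlgebra.ι k z)) :
    gen k x * gen k y = gen k z := by
  rw [gen_mul_gen, RingQuot.mkAlgHom_rel k h, gen]

theorem gen_mul_gen_eq_zero {x y : ULift.{u} Bool ⊕ ULift.{u} Bool}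
    (h : GentleRel k twoCycle.{u} (FreeAlgebra.ι k y * FreeAlgebra.ι k x) 0) :
    gen k x * gen k y = 0 := by
  rw [gen_mul_gen, RingQuot.mkAlgHom_rel k h, map_zero, MulOpposite.op_zero]

theorem e₁_mul_e₁ : e₁ k * e₁ k = e₁ k := gen_mul_gen_of_rel (.idem _)
theorem e₂_mul_e₂ : e₂ k * e₂ k = e₂ k := gen_mul_gen_of_rel (.idem _)
theorem e₁_mul_e₂ : e₁ k * e₂ k = 0 := gen_mul_gen_eq_zero (.orth _ _ (by simp))
theorem e₂_mul_e₁ : e₂ k * e₁ k = 0 := gen_mul_gen_eq_zero (.orth _ _ (by simp))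
theorem a_mul_e₁ : a k * e₁ k = a k := gen_mul_gen_of_rel (.src_mul _)
theorem e₂_mul_a : e₂ k * a k = a k := gen_mul_gen_of_rel (.mul_tgt _)
theorem b_mul_e₂ : b k * e₂ k = b k := gen_mul_gen_of_rel (.src_mul _)
theorem e₁_mul_b : e₁ k * b k = b k := gen_mul_gen_of_rel (.mul_tgt _)
theorem b_mul_a : b k * a k = 0 := gen_mul_gen_eq_zero (.relation _ _ ⟨rfl, rfl⟩)

theorem e₁_mul_a : e₁ k * a k = 0 := by
  rw [← e₂_mul_a, ← mul_assoc, e₁_mul_e₂, zero_mul]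

theorem e₂_mul_b : e₂ k * b k = 0 := by
  rw [← e₁_mul_b, ← mul_assoc, e₂_mul_e₁, zero_mul]

theorem a_mul_e₂ : a k * e₂ k = 0 := by
  rw [← a_mul_e₁, mul_assoc, e₁_mul_e₂, mul_zero]

theorem b_mul_e₁ : b k * e₁ k = 0 := by
  rw [← b_mul_e₂, mul_assoc, e₂_mul_e₁, mul_zero]

theorem a_mul_a : a k * a k = 0 := by
  nth_rw 2 [← e₂_mul_a]
  rw [← mul_assoc, a_mul_e₂, zero_mul]

theorem b_mul_b : b k * b k = 0 := by
  nth_rw 2 [← e₁_mul_b]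
  rw [← mul_assoc, b_mul_e₁, zero_mul]

theorem e₁_add_e₂ : e₁ k + e₂ k = 1 := by
  have h := RingQuot.mkAlgHom_rel k (GentleRel.sum_idem (k := k) (Q := twoCycle.{u}))
  have h2 : ∑ v : ULift.{u} Bool, (FreeAlgebra.ι k (Sum.inl v) :
      FreeAlgebra k (ULift.{u} Bool ⊕ ULift.{u} Bool)) =
      FreeAlgebra.ι k (Sum.inl ⟨true⟩) + FreeAlgebra.ι k (Sum.inl ⟨false⟩) := by
    rw [← Equiv.ulift.symm.sum_comp, Fintype.sum_bool]
    rfl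
  rw [e₁, e₂, gen, gen, ← MulOpposite.op_add, ← map_add, add_comm, ← h2]
  refine (congrArg MulOpposite.op h).trans ?_
  rw [map_one, MulOpposite.op_one]

section Actions

variable {X : Type*} [AddCommGroup X] [Module (TwoCycleOp k) X] (x : X)

@[simp] theorem e₁_smul_e₁ : e₁ k • e₁ k • x = e₁ k • x := by rw [smul_smul, e₁_mul_e₁]
@[simp] theorem e₂_smul_e₂ : e₂ k • e₂ k • x = e₂ k • x := by rw [smul_smul, e₂_mul_e₂]
@[simp] theorem e₁_smul_e₂ : e₁ k • e₂ k • x = 0 := by rw [smul_smul, e₁_mul_e₂, zero_smul]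
@[simp] theorem e₂_smul_e₁ : e₂ k • e₁ k • x = 0 := by rw [smul_smul, e₂_mul_e₁, zero_smul]
@[simp] theorem a_smul_e₁ : a k • e₁ k • x = a k • x := by rw [smul_smul, a_mul_e₁]
@[simp] theorem e₂_smul_a : e₂ k • a k • x = a k • x := by rw [smul_smul, e₂_mul_a]
@[simp] theorem b_smul_e₂ : b k • e₂ k • x = b k • x := by rw [smul_smul, b_mul_e₂]
@[simp] theorem e₁_smul_b : e₁ k • b k • x = b k • x := by rw [smul_smul, e₁_mul_b]
@[simp] theorem b_smul_a : b k • a k • x = 0 := by rw [smul_smul, b_mul_a, zero_smul]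
@[simp] theorem e₁_smul_a : e₁ k • a k • x = 0 := by rw [smul_smul, e₁_mul_a, zero_smul]
@[simp] theorem e₂_smul_b : e₂ k • b k • x = 0 := by rw [smul_smul, e₂_mul_b, zero_smul]
@[simp] theorem a_smul_e₂ : a k • e₂ k • x = 0 := by rw [smul_smul, a_mul_e₂, zero_smul]
@[simp] theorem b_smul_e₁ : b k • e₁ k • x = 0 := by rw [smul_smul, b_mul_e₁, zero_smul]
@[simp] theorem a_smul_a : a k • a k • x = 0 := by rw [smul_smul, a_mul_a, zero_smul]
@[simp] theorem b_smul_b : b k • b k • x = 0 := by rw [smul_smul, b_mul_b, zero_smul]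

theorem e₁_smul_add_e₂_smul : e₁ k • x + e₂ k • x = x := by
  rw [← add_smul, e₁_add_e₂, one_smul]

end Actions

section Linear

variable {X Y : Type*} [AddCommGroup X] [AddCommGroup Y] [Module (TwoCycleOp k) X]
  [Module (TwoCycleOp k) Y] [Module k X] [Module k Y] [IsScalarTower k (TwoCycleOp k) X]
  [IsScalarTower k (TwoCycleOp k) Y]

/-- A `k`-linear map commuting with the generators is a module homomorphism. -/
def homOfComm (f : X →ₗ[k] Y) (h₁ : ∀ x, f (e₁ k • x) = e₁ k • f x)
    (h₂ : ∀ x, f (e₂ k • x) = e₂ k • f x) (ha : ∀ x, f (a k • x) = a k • f x)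
    (hb : ∀ x, f (b k • x) = b k • f x) : X →ₗ[TwoCycleOp k] Y where
  toFun := f
  map_add' := map_add f
  map_smul' c x := by
    obtain ⟨z, hz⟩ := RingQuot.mkAlgHom_surjective k (GentleRel k twoCycle.{u}) c.unop
    have hc : c = MulOpposite.op (RingQuot.mkAlgHom k (GentleRel k twoCycle.{u}) z) := by
      rw [hz, MulOpposite.op_unop]
    rw [hc, RingHom.id_apply]
    clear hc hz c
    induction z generalizing x with
    | grade0 r =>
      rw [AlgHom.commutes]
      change f (algebraMap k (TwoCycleOp k) r • x) = algebraMap k (TwoCycleOp k) r • f x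
      rw [algebraMap_smul, algebraMap_smul, map_smul]
    | grade1 v =>
      rcases v with ⟨_ | _⟩ | ⟨_ | _⟩
      exacts [h₁ x, h₂ x, ha x, hb x]
    | mul y z hy hz => rw [map_mul, MulOpposite.op_mul, mul_smul, mul_smul, hz, hy]
    | add y z hy hz => rw [map_add, MulOpposite.op_add, add_smul, add_smul, map_add, hy, hz]

end Linear

section Representations

variable {V W : Type u} [AddCommGroup V] [AddCommGroup W] [Module k V] [Module k W]

/-- The action of the generators on the representation with spaces `V`, `W` and maps `f`, `g`. -/
def repGen (f : V →ₗ[k] W) (g : W →ₗ[k] V) :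
    ULift.{u} Bool ⊕ ULift.{u} Bool → Module.End k (V × W)
  | Sum.inl ⟨false⟩ => LinearMap.inl k V W ∘ₗ LinearMap.fst k V W
  | Sum.inl ⟨true⟩ => LinearMap.inr k V W ∘ₗ LinearMap.snd k V W
  | Sum.inr ⟨false⟩ => LinearMap.inr k V W ∘ₗ f ∘ₗ LinearMap.fst k V W
  | Sum.inr ⟨true⟩ => LinearMap.inl k V W ∘ₗ g ∘ₗ LinearMap.snd k V W

/-- The algebra homomorphism defining the representation `(V, W, f, g)`. -/
noncomputable def repHom (f : V →ₗ[k] W) (g : W →ₗ[k] V) (h : g ∘ₗ f = 0) :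
    TwoCycleOp k →ₐ[k] Module.End k (V × W) :=
  AlgHom.opComm (RingQuot.liftAlgHom k
    ⟨FreeAlgebra.lift k fun x => MulOpposite.op (repGen f g x), by
      have h' : ∀ v, g (f v) = 0 := LinearMap.congr_fun h
      intro x y hxy
      induction hxy with
      | idem v =>
        rcases v with ⟨_ | _⟩ <;>
          simp only [map_mul, FreeAlgebra.lift_ι_apply, ← MulOpposite.op_mul] <;>
          refine congrArg MulOpposite.op (LinearMap.ext fun v => ?_) <;> simp [repGen]
      | orth v w hvw =>
        rcases v with ⟨_ | _⟩ <;> rcases w with ⟨_ | _⟩ <;> first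
          | exact absurd rfl hvw
          | simp only [map_mul, FreeAlgebra.lift_ι_apply, ← MulOpposite.op_mul, map_zero]
            rw [← MulOpposite.op_zero]
            refine congrArg MulOpposite.op (LinearMap.ext fun v => ?_)
            simp [repGen]
      | sum_idem =>
        rw [map_sum, map_one, ← Equiv.ulift.symm.sum_comp, Fintype.sum_bool,
          FreeAlgebra.lift_ι_apply, FreeAlgebra.lift_ι_apply, ← MulOpposite.op_add,
          ← MulOpposite.op_one]
        refine congrArg MulOpposite.op (LinearMap.ext fun v => ?_)
        simp [repGen]
      | src_mul x =>
        rcases x with ⟨_ | _⟩ <;>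
          simp only [map_mul, FreeAlgebra.lift_ι_apply, ← MulOpposite.op_mul] <;>
          refine congrArg MulOpposite.op (LinearMap.ext fun v => ?_) <;> simp [repGen]
      | mul_tgt x =>
        rcases x with ⟨_ | _⟩ <;>
          simp only [map_mul, FreeAlgebra.lift_ι_apply, ← MulOpposite.op_mul] <;>
          refine congrArg MulOpposite.op (LinearMap.ext fun v => ?_) <;> simp [repGen]
      | relation x y hxy =>
        obtain ⟨rfl, rfl⟩ := hxy
        simp only [map_mul, FreeAlgebra.lift_ι_apply, ← MulOpposite.op_mul, map_zero]
        rw [← MulOpposite.op_zero]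
        refine congrArg MulOpposite.op (LinearMap.ext fun v => ?_)
        simp [repGen, h']⟩)

theorem repHom_gen (f : V →ₗ[k] W) (g : W →ₗ[k] V) (h : g ∘ₗ f = 0)
    (x : ULift.{u} Bool ⊕ ULift.{u} Bool) : repHom f g h (gen k x) = repGen f g x := by
  rw [repHom, gen]
  change MulOpposite.unop (RingQuot.liftAlgHom k _ (RingQuot.mkAlgHom k _ _)) = _
  rw [RingQuot.liftAlgHom_mkAlgHom_apply, FreeAlgebra.lift_ι_apply, MulOpposite.unop_op]

/-- The module given by a representation `(V, W, f, g)` of the quiver. -/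
@[ext]
structure Rep (f : V →ₗ[k] W) (g : W →ₗ[k] V) (h : g ∘ₗ f = 0) : Type u where
  /-- the component at the first vertex -/
  fst : V
  /-- the component at the second vertex -/
  snd : W

namespace Rep

variable {f : V →ₗ[k] W} {g : W →ₗ[k] V} {h : g ∘ₗ f = 0}

/-- The underlying space of a representation. -/
def equivProd (f : V →ₗ[k] W) (g : W →ₗ[k] V) (h : g ∘ₗ f = 0) : Rep f g h ≃ V × W where
  toFun w := (w.fst, w.snd)
  invFun w := ⟨w.1, w.2⟩
  left_inv _ := rfl
  right_inv _ := rfl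

instance : AddCommGroup (Rep f g h) := (equivProd f g h).addCommGroup

instance : Module k (Rep f g h) := (equivProd f g h).module k

noncomputable instance : Module (TwoCycleOp k) (Rep f g h) :=
  letI : Module (TwoCycleOp k) (V × W) := Module.compHom (V × W) (repHom f g h).toRingHom
  (equivProd f g h).module (TwoCycleOp k)

theorem smul_def (c : TwoCycleOp k) (w : Rep f g h) :
    c • w = ⟨(repHom f g h c (w.fst, w.snd)).1, (repHom f g h c (w.fst, w.snd)).2⟩ := rfl

instance : IsScalarTower k (TwoCycleOp k) (Rep f g h) where
  smul_assoc r c w := by rw [smul_def, map_smul]; rfl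

@[simp] theorem zero_fst : (0 : Rep f g h).fst = 0 := rfl
@[simp] theorem zero_snd : (0 : Rep f g h).snd = 0 := rfl
@[simp] theorem add_fst (v w : Rep f g h) : (v + w).fst = v.fst + w.fst := rfl
@[simp] theorem add_snd (v w : Rep f g h) : (v + w).snd = v.snd + w.snd := rfl
@[simp] theorem smul_fst (r : k) (w : Rep f g h) : (r • w).fst = r • w.fst := rfl
@[simp] theorem smul_snd (r : k) (w : Rep f g h) : (r • w).snd = r • w.snd := rfl

theorem e₁_smul (w : Rep f g h) : e₁ k • w = ⟨w.fst, 0⟩ := by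
  rw [smul_def, e₁, repHom_gen]; rfl

theorem e₂_smul (w : Rep f g h) : e₂ k • w = ⟨0, w.snd⟩ := by
  rw [smul_def, e₂, repHom_gen]; rfl

theorem a_smul (w : Rep f g h) : a k • w = ⟨0, f w.fst⟩ := by
  rw [smul_def, a, repHom_gen]; rfl

theorem b_smul (w : Rep f g h) : b k • w = ⟨g w.snd, 0⟩ := by
  rw [smul_def, b, repHom_gen]; rfl

@[simp] theorem e₁_smul_fst (w : Rep f g h) : (e₁ k • w).fst = w.fst := by rw [e₁_smul]
@[simp] theorem e₁_smul_snd (w : Rep f g h) : (e₁ k • w).snd = 0 := by rw [e₁_smul]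
@[simp] theorem e₂_smul_fst (w : Rep f g h) : (e₂ k • w).fst = 0 := by rw [e₂_smul]
@[simp] theorem e₂_smul_snd (w : Rep f g h) : (e₂ k • w).snd = w.snd := by rw [e₂_smul]
@[simp] theorem a_smul_fst (w : Rep f g h) : (a k • w).fst = 0 := by rw [a_smul]
@[simp] theorem a_smul_snd (w : Rep f g h) : (a k • w).snd = f w.fst := by rw [a_smul]
@[simp] theorem b_smul_fst (w : Rep f g h) : (b k • w).fst = g w.snd := by rw [b_smul]
@[simp] theorem b_smul_snd (w : Rep f g h) : (b k • w).snd = 0 := by rw [b_smul]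

variable {X : Type*} [AddCommGroup X] [Module (TwoCycleOp k) X] [Module k X]
  [IsScalarTower k (TwoCycleOp k) X]

/-- A module homomorphism into a representation, from its two components. -/
noncomputable def homTo (f : V →ₗ[k] W) (g : W →ₗ[k] V) (h : g ∘ₗ f = 0)
    (p : X →ₗ[k] V) (q : X →ₗ[k] W)
    (hp : ∀ x, p (e₂ k • x) = 0) (hq : ∀ x, q (e₁ k • x) = 0)
    (ha : ∀ x, q (a k • x) = f (p x)) (hb : ∀ x, p (b k • x) = g (q x)) :
    X →ₗ[TwoCycleOp k] Rep f g h :=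
  homOfComm (k := k)
    { toFun := fun x => ⟨p x, q x⟩
      map_add' := fun x y => Rep.ext (map_add p x y) (map_add q x y)
      map_smul' := fun r x => Rep.ext (map_smul p r x) (map_smul q r x) }
    (fun x => by
      have := congrArg p (e₁_smul_add_e₂_smul (k := k) x)
      rw [map_add, hp, add_zero] at this
      exact Rep.ext (by simp [this]) (by simp [hq]))
    (fun x => by
      have := congrArg q (e₁_smul_add_e₂_smul (k := k) x)
      rw [map_add, hq, zero_add] at this
      exact Rep.ext (by simp [hp]) (by simp [this]))
    (fun x => Rep.ext (by simpa using hp (a k • x)) (by simp [ha]))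
    (fun x => Rep.ext (by simp [hb]) (by simpa using hq (b k • x)))

/-- A module homomorphism out of a representation, from its two components. -/
noncomputable def homFrom (f : V →ₗ[k] W) (g : W →ₗ[k] V) (h : g ∘ₗ f = 0)
    (p : V →ₗ[k] X) (q : W →ₗ[k] X)
    (hp : ∀ v, e₁ k • p v = p v) (hq : ∀ w, e₂ k • q w = q w)
    (ha : ∀ v, a k • p v = q (f v)) (hb : ∀ w, b k • q w = p (g w)) :
    Rep f g h →ₗ[TwoCycleOp k] X :=
  homOfComm (k := k)
    { toFun := fun x => p x.fst + q x.snd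
      map_add' := fun x y => by simp only [add_fst, add_snd, map_add]; abel
      map_smul' := fun r x => by simp }
    (fun x => by simp [hp, show e₁ k • q x.snd = 0 by rw [← hq, e₁_smul_e₂]])
    (fun x => by simp [hq, show e₂ k • p x.fst = 0 by rw [← hp, e₂_smul_e₁]])
    (fun x => by simp [ha, show a k • q x.snd = 0 by rw [← hq, a_smul_e₂]])
    (fun x => by simp [hb, show b k • p x.fst = 0 by rw [← hp, b_smul_e₁]])

@[simp] theorem homTo_fst (p : X →ₗ[k] V) (q : X →ₗ[k] W) (hp hq ha hb) (x : X) :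
    (homTo f g h p q hp hq ha hb x).fst = p x := rfl

@[simp] theorem homTo_snd (p : X →ₗ[k] V) (q : X →ₗ[k] W) (hp hq ha hb) (x : X) :
    (homTo f g h p q hp hq ha hb x).snd = q x := rfl

@[simp] theorem homFrom_apply (p : V →ₗ[k] X) (q : W →ₗ[k] X) (hp hq ha hb) (w : Rep f g h) :
    homFrom f g h p q hp hq ha hb w = p w.fst + q w.snd := rfl

end Rep

end Representations

namespace Rep

variable {V W V' W' : Type u} [AddCommGroup V] [AddCommGroup W] [Module k V] [Module k W]
  [AddCommGroup V'] [AddCommGroup W'] [Module k V'] [Module k W']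
  {f : V →ₗ[k] W} {g : W →ₗ[k] V} {h : g ∘ₗ f = 0}
  {f' : V' →ₗ[k] W'} {g' : W' →ₗ[k] V'} {h' : g' ∘ₗ f' = 0}

variable (f g h) in
/-- The projection to the first component. -/
def fstHom : Rep f g h →ₗ[k] V where
  toFun := fst
  map_add' _ _ := rfl
  map_smul' _ _ := rfl

variable (f g h) in
/-- The projection to the second component. -/
def sndHom : Rep f g h →ₗ[k] W where
  toFun := snd
  map_add' _ _ := rfl
  map_smul' _ _ := rfl

@[simp] theorem fstHom_apply (w : Rep f g h) : fstHom f g h w = w.fst := rfl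
@[simp] theorem sndHom_apply (w : Rep f g h) : sndHom f g h w = w.snd := rfl

/-- A morphism of representations induces a module homomorphism. -/
noncomputable def map (p : V →ₗ[k] V') (q : W →ₗ[k] W') (hf : ∀ v, q (f v) = f' (p v))
    (hg : ∀ w, p (g w) = g' (q w)) : Rep f g h →ₗ[TwoCycleOp k] Rep f' g' h' :=
  homTo f' g' h' (p ∘ₗ fstHom f g h) (q ∘ₗ sndHom f g h) (by simp) (by simp) (by simp [hf])
    (by simp [hg])

@[simp] theorem map_fst (p : V →ₗ[k] V') (q : W →ₗ[k] W') (hf hg) (w : Rep f g h) :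
    (map (h' := h') p q hf hg w).fst = p w.fst := rfl

@[simp] theorem map_snd (p : V →ₗ[k] V') (q : W →ₗ[k] W') (hf hg) (w : Rep f g h) :
    (map (h' := h') p q hf hg w).snd = q w.snd := rfl

instance [Module.Finite k V] [Module.Finite k W] : Module.Finite k (Rep f g h) :=
  Module.Finite.of_injective ((fstHom f g h).prod (sndHom f g h)) fun _ _ hxy =>
    Rep.ext (congrArg Prod.fst hxy) (congrArg Prod.snd hxy)

end Rep

variable (k)

/-- The indecomposable projective at the first vertex. -/
abbrev P₁ : Type u := Rep (LinearMap.id : k →ₗ[k] k) 0 (LinearMap.zero_comp _)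

/-- The indecomposable projective-injective module, of length three. -/
abbrev P₂ : Type u := Rep (LinearMap.inr k k k) (LinearMap.fst k k k) (LinearMap.fst_comp_inr k k k)

/-- The simple module at the first vertex. -/
abbrev S₁ : Type u := Rep (0 : k →ₗ[k] PUnit.{u + 1}) 0 (LinearMap.zero_comp _)

/-- The simple module at the second vertex. -/
abbrev S₂ : Type u := Rep (0 : PUnit.{u + 1} →ₗ[k] k) 0 (LinearMap.zero_comp _)

/-- The indecomposable injective module at the first vertex. -/
abbrev I₁ : Type u := Rep (0 : k →ₗ[k] k) LinearMap.id (LinearMap.comp_zero _)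

variable {k}

section Generators

variable {X : Type*} [AddCommGroup X] [Module (TwoCycleOp k) X] [Module k X]
  [IsScalarTower k (TwoCycleOp k) X]

/-- The homomorphism from `P₁` corresponding to an element. -/
noncomputable def fromP₁ (x : X) : P₁ k →ₗ[TwoCycleOp k] X :=
  Rep.homFrom _ _ _ (LinearMap.toSpanSingleton k X (e₁ k • x))
    (LinearMap.toSpanSingleton k X (a k • x))
    (by simp [smul_comm _ (_ : k)]) (by simp [smul_comm _ (_ : k)])
    (by simp [smul_comm _ (_ : k)]) (by simp [smul_comm _ (_ : k)])

theorem fromP₁_apply (x : X) (w : P₁ k) : fromP₁ x w = w.fst • e₁ k • x + w.snd • a k • x := rfl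

/-- The homomorphism from `P₂` corresponding to an element. -/
noncomputable def fromP₂ (x : X) : P₂ k →ₗ[TwoCycleOp k] X :=
  Rep.homFrom _ _ _ (LinearMap.toSpanSingleton k X (b k • x))
    ((LinearMap.toSpanSingleton k X (e₂ k • x)).coprod
      (LinearMap.toSpanSingleton k X (a k • b k • x)))
    (by simp [smul_comm _ (_ : k)]) (by simp [smul_comm _ (_ : k)])
    (by simp [smul_comm _ (_ : k)]) (by simp [smul_comm _ (_ : k)])

theorem fromP₂_apply (x : X) (w : P₂ k) :
    fromP₂ x w = w.fst • b k • x + (w.snd.1 • e₂ k • x + w.snd.2 • a k • b k • x) := rfl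

/-- The homomorphism from `I₁` corresponding to an element killed by `a b`. -/
noncomputable def fromI₁ (x : X) (hx : a k • b k • x = 0) : I₁ k →ₗ[TwoCycleOp k] X :=
  Rep.homFrom _ _ _ (LinearMap.toSpanSingleton k X (b k • x))
    (LinearMap.toSpanSingleton k X (e₂ k • x))
    (by simp [smul_comm _ (_ : k)]) (by simp [smul_comm _ (_ : k)])
    (by simp [smul_comm _ (_ : k), hx]) (by simp [smul_comm _ (_ : k)])

theorem fromI₁_apply (x : X) (hx : a k • b k • x = 0) (w : I₁ k) :
    fromI₁ x hx w = w.fst • b k • x + w.snd • e₂ k • x := rfl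

/-- The homomorphism from `S₁` corresponding to an element killed by `a`. -/
noncomputable def fromS₁ (x : X) (hx : a k • x = 0) : S₁ k →ₗ[TwoCycleOp k] X :=
  Rep.homFrom _ _ _ (LinearMap.toSpanSingleton k X (e₁ k • x)) 0
    (by simp [smul_comm _ (_ : k)]) (by simp)
    (by simp [smul_comm _ (_ : k), hx]) (by simp)

theorem fromS₁_apply (x : X) (hx : a k • x = 0) (w : S₁ k) :
    fromS₁ x hx w = w.fst • e₁ k • x + 0 := rfl

/-- The homomorphism from `S₂` corresponding to an element killed by `b`. -/
noncomputable def fromS₂ (x : X) (hx : b k • x = 0) : S₂ k →ₗ[TwoCycleOp k] X :=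
  Rep.homFrom _ _ _ 0 (LinearMap.toSpanSingleton k X (e₂ k • x))
    (by simp) (by simp [smul_comm _ (_ : k)])
    (by simp) (by simp [smul_comm _ (_ : k), hx])

theorem fromS₂_apply (x : X) (hx : b k • x = 0) (w : S₂ k) :
    fromS₂ x hx w = 0 + w.snd • e₂ k • x := rfl

/-- The functional `x ↦ φ (c x)`. -/
def twist (φ : X →ₗ[k] k) (c : TwoCycleOp k) : X →ₗ[k] k where
  toFun x := φ (c • x)
  map_add' x y := by rw [smul_add, map_add]
  map_smul' r x := by rw [smul_comm, map_smul, RingHom.id_apply]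

@[simp] theorem twist_apply (φ : X →ₗ[k] k) (c : TwoCycleOp k) (x : X) :
    twist φ c x = φ (c • x) := rfl

/-- The homomorphism to `P₂` corresponding to a functional. -/
noncomputable def toP₂ (φ : X →ₗ[k] k) : X →ₗ[TwoCycleOp k] P₂ k :=
  Rep.homTo _ _ _ (twist φ (a k)) ((twist φ (a k * b k)).prod (twist φ (e₂ k)))
    (by simp) (by simp [mul_smul]) (by simp [mul_smul]) (by simp [mul_smul])

@[simp] theorem toP₂_fst (φ : X →ₗ[k] k) (x : X) :
    (toP₂ φ x).fst = φ (a k • x) := rfl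

@[simp] theorem toP₂_snd (φ : X →ₗ[k] k) (x : X) :
    (toP₂ φ x).snd = (φ ((a k * b k) • x), φ (e₂ k • x)) := rfl

/-- The homomorphism to `I₁` corresponding to a functional. -/
noncomputable def toI₁ (φ : X →ₗ[k] k) : X →ₗ[TwoCycleOp k] I₁ k :=
  Rep.homTo _ _ _ (twist φ (e₁ k)) (twist φ (b k)) (by simp) (by simp) (by simp) (by simp)

@[simp] theorem toI₁_fst (φ : X →ₗ[k] k) (x : X) : (toI₁ φ x).fst = φ (e₁ k • x) := rfl

@[simp] theorem toI₁_snd (φ : X →ₗ[k] k) (x : X) : (toI₁ φ x).snd = φ (b k • x) := rfl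

/-- The homomorphism to `P₁` corresponding to a functional, on a module killed by `a b`. -/
noncomputable def toP₁ (hX : ∀ x : X, a k • b k • x = 0) (φ : X →ₗ[k] k) :
    X →ₗ[TwoCycleOp k] P₁ k :=
  Rep.homTo _ _ _ (twist φ (a k)) (twist φ (e₂ k)) (by simp) (by simp) (by simp) (by simp [hX])

@[simp] theorem toP₁_fst (hX : ∀ x : X, a k • b k • x = 0) (φ : X →ₗ[k] k) (x : X) :
    (toP₁ hX φ x).fst = φ (a k • x) := rfl

@[simp] theorem toP₁_snd (hX : ∀ x : X, a k • b k • x = 0) (φ : X →ₗ[k] k) (x : X) :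
    (toP₁ hX φ x).snd = φ (e₂ k • x) := rfl

/-- The homomorphism to `S₁` corresponding to a functional, on a module killed by `b`. -/
noncomputable def toS₁ (hX : ∀ x : X, b k • x = 0) (φ : X →ₗ[k] k) :
    X →ₗ[TwoCycleOp k] S₁ k :=
  Rep.homTo _ _ _ (twist φ (e₁ k)) 0 (by simp) (by simp) (by simp) (by simp [hX])

@[simp] theorem toS₁_fst (hX : ∀ x : X, b k • x = 0) (φ : X →ₗ[k] k) (x : X) :
    (toS₁ hX φ x).fst = φ (e₁ k • x) := rfl

/-- The homomorphism to `S₂` corresponding to a functional, on a module killed by `a`. -/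
noncomputable def toS₂ (hX : ∀ x : X, a k • x = 0) (φ : X →ₗ[k] k) :
    X →ₗ[TwoCycleOp k] S₂ k :=
  Rep.homTo _ _ _ 0 (twist φ (e₂ k)) (by simp) (by simp) (by simp [hX]) (by simp)

@[simp] theorem toS₂_snd (hX : ∀ x : X, a k • x = 0) (φ : X →ₗ[k] k) (x : X) :
    (toS₂ hX φ x).snd = φ (e₂ k • x) := rfl

end Generators

/-- Over an algebra over a field, functionals extend along injective module homomorphisms. -/
theorem exists_functional_extension {X Y : Type*} [AddCommGroup X] [AddCommGroup Y]
    [Module (TwoCycleOp k) X] [Module (TwoCycleOp k) Y] [Module k X] [Module k Y]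
    [IsScalarTower k (TwoCycleOp k) X] [IsScalarTower k (TwoCycleOp k) Y]
    (i : X →ₗ[TwoCycleOp k] Y) (hi : Function.Injective i) (φ : X →ₗ[k] k) :
    ∃ ψ : Y →ₗ[k] k, ∀ x, ψ (i x) = φ x := by
  obtain ⟨r, hr⟩ := (i.restrictScalars k).exists_leftInverse_of_injective
    (LinearMap.ker_eq_bot.mpr hi)
  exact ⟨φ ∘ₗ r, fun x => congrArg φ (LinearMap.congr_fun hr x)⟩

theorem exists_extension_P₂ {X Y : Type*} [AddCommGroup X] [AddCommGroup Y]
    [Module (TwoCycleOp k) X] [Module (TwoCycleOp k) Y] [Module k X] [Module k Y]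
    [IsScalarTower k (TwoCycleOp k) X] [IsScalarTower k (TwoCycleOp k) Y]
    (i : X →ₗ[TwoCycleOp k] Y) (hi : Function.Injective i)
    (g : X →ₗ[TwoCycleOp k] P₂ k) : ∃ g' : Y →ₗ[TwoCycleOp k] P₂ k, ∀ x, g' (i x) = g x := by
  obtain ⟨ψ, hψ⟩ := exists_functional_extension i hi
    (LinearMap.snd k k k ∘ₗ Rep.sndHom _ _ _ ∘ₗ g.restrictScalars k)
  have hψ' (c : TwoCycleOp k) (x : X) : ψ (c • i x) = (c • g x).snd.2 := by
    rw [← map_smul, ← map_smul]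
    exact hψ _
  refine ⟨toP₂ ψ, fun x => ?_⟩
  have hab : ((a k * b k) • g x).snd.2 = (g x).snd.1 := by simp [mul_smul]
  ext <;> simp [hψ', hab]

theorem injective_P₂ : Module.Injective (TwoCycleOp k) (P₂ k) where
  out X Y _ _ _ _ i hi g :=
    let := Module.restrictScalars k (TwoCycleOp k) X
    let := Module.restrictScalars k (TwoCycleOp k) Y
    have : IsScalarTower k (TwoCycleOp k) X := IsScalarTower.restrictScalars _ _ _
    have : IsScalarTower k (TwoCycleOp k) Y := IsScalarTower.restrictScalars _ _ _
    exists_extension_P₂ (k := k) i hi g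

theorem exists_extension_I₁ {X Y : Type*} [AddCommGroup X] [AddCommGroup Y]
    [Module (TwoCycleOp k) X] [Module (TwoCycleOp k) Y] [Module k X] [Module k Y]
    [IsScalarTower k (TwoCycleOp k) X] [IsScalarTower k (TwoCycleOp k) Y]
    (i : X →ₗ[TwoCycleOp k] Y) (hi : Function.Injective i)
    (g : X →ₗ[TwoCycleOp k] I₁ k) : ∃ g' : Y →ₗ[TwoCycleOp k] I₁ k, ∀ x, g' (i x) = g x := by
  obtain ⟨ψ, hψ⟩ := exists_functional_extension i hi
    (Rep.fstHom _ _ _ ∘ₗ g.restrictScalars k)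
  have hψ' (c : TwoCycleOp k) (x : X) : ψ (c • i x) = (c • g x).fst := by
    rw [← map_smul, ← map_smul]
    exact hψ _
  refine ⟨toI₁ ψ, fun x => ?_⟩
  ext <;> simp [hψ']

theorem injective_I₁ : Module.Injective (TwoCycleOp k) (I₁ k) where
  out X Y _ _ _ _ i hi g :=
    let := Module.restrictScalars k (TwoCycleOp k) X
    let := Module.restrictScalars k (TwoCycleOp k) Y
    have : IsScalarTower k (TwoCycleOp k) X := IsScalarTower.restrictScalars _ _ _
    have : IsScalarTower k (TwoCycleOp k) Y := IsScalarTower.restrictScalars _ _ _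
    exists_extension_I₁ (k := k) i hi g

variable (k) in
/-- The regular module is the direct sum of the two indecomposable projectives. -/
noncomputable def regularEquiv : (P₁ k × P₂ k) ≃ₗ[TwoCycleOp k] TwoCycleOp k :=
  LinearEquiv.ofLinearMap ((fromP₁ (1 : TwoCycleOp k)).coprod (fromP₂ (1 : TwoCycleOp k)))
    (LinearMap.toSpanSingleton (TwoCycleOp k) (P₁ k × P₂ k) (⟨1, 0⟩, ⟨0, (1, 0)⟩))
    (by
      refine LinearMap.ext_ring ?_
      simp [fromP₁_apply, fromP₂_apply, e₁_add_e₂])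
    (by
      refine LinearMap.ext fun ⟨v, w⟩ => Prod.ext ?_ ?_ <;> ext <;>
        simp [fromP₁_apply, fromP₂_apply, add_smul, mul_smul])

theorem projective_P₁ : Module.Projective (TwoCycleOp k) (P₁ k) :=
  Module.Projective.of_split ((regularEquiv k).toLinearMap ∘ₗ LinearMap.inl _ _ _)
    (LinearMap.fst _ _ _ ∘ₗ (regularEquiv k).symm.toLinearMap) (by ext <;> simp)

theorem projective_P₂ : Module.Projective (TwoCycleOp k) (P₂ k) :=
  Module.Projective.of_split ((regularEquiv k).toLinearMap ∘ₗ LinearMap.inr _ _ _)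
    (LinearMap.snd _ _ _ ∘ₗ (regularEquiv k).symm.toLinearMap) (by ext <;> simp)

theorem finiteDimensional_gentleAlg : FiniteDimensional k (GentleAlg k twoCycle.{u}) := by
  have : Module.Finite k (TwoCycleOp k) :=
    Module.Finite.equiv ((regularEquiv k).restrictScalars k)
  exact Module.Finite.equiv (MulOpposite.opLinearEquiv k (M := GentleAlg k twoCycle.{u})).symm


section LoopExact

variable {X Y : Type*} [AddCommGroup X] [AddCommGroup Y] [Module (TwoCycleOp k) X]
  [Module (TwoCycleOp k) Y]

variable (k X) in
/-- The loop `ab` at the second vertex, which squares to zero, acts exactly. -/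
def LoopExact : Prop :=
  ∀ x : X, e₂ k • x = x → a k • b k • x = 0 → ∃ y : X, x = a k • b k • y

theorem LoopExact.prod (hX : LoopExact k X) (hY : LoopExact k Y) : LoopExact k (X × Y) := by
  intro x h₁ h₂
  obtain ⟨y, hy⟩ := hX x.1 (congrArg Prod.fst h₁) (congrArg Prod.fst h₂)
  obtain ⟨z, hz⟩ := hY x.2 (congrArg Prod.snd h₁) (congrArg Prod.snd h₂)
  exact ⟨(y, z), Prod.ext hy hz⟩

theorem LoopExact.pi {ι : Type*} (hX : LoopExact k X) : LoopExact k (ι → X) := by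
  intro x h₁ h₂
  choose y hy using fun i => hX (x i) (congrFun h₁ i) (congrFun h₂ i)
  exact ⟨y, funext hy⟩

theorem LoopExact.of_retract (hX : LoopExact k X) (s : Y →ₗ[TwoCycleOp k] X)
    (r : X →ₗ[TwoCycleOp k] Y) (h : ∀ y, r (s y) = y) : LoopExact k Y := by
  intro y h₁ h₂
  obtain ⟨z, hz⟩ := hX (s y) (by rw [← map_smul, h₁])
    (by rw [← map_smul, ← map_smul, h₂, map_zero])
  exact ⟨r z, by rw [← map_smul, ← map_smul, ← hz, h]⟩

theorem LoopExact.of_equiv (hX : LoopExact k X) (e : X ≃ₗ[TwoCycleOp k] Y) : LoopExact k Y :=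
  hX.of_retract e.symm.toLinearMap e.toLinearMap e.apply_symm_apply

theorem LoopExact.of_injective (hX : LoopExact k X) (i : Y →ₗ[TwoCycleOp k] X)
    (hi : Function.Injective i) (hC : LoopExact k (X ⧸ LinearMap.range i)) : LoopExact k Y := by
  intro y h₁ h₂
  obtain ⟨x, hx⟩ := hX (i y) (by rw [← map_smul, h₁])
    (by rw [← map_smul, ← map_smul, h₂, map_zero])
  obtain ⟨z, hz⟩ := hC (Submodule.Quotient.mk (e₂ k • x)) (by simp [← Submodule.Quotient.mk_smul])
    (by
      rw [← Submodule.Quotient.mk_smul, ← Submodule.Quotient.mk_smul, b_smul_e₂, ← hx,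
        Submodule.Quotient.mk_eq_zero]
      exact ⟨y, rfl⟩)
  obtain ⟨z, rfl⟩ := Submodule.Quotient.mk_surjective _ z
  rw [← Submodule.Quotient.mk_smul, ← Submodule.Quotient.mk_smul, Submodule.Quotient.eq] at hz
  obtain ⟨w, hw⟩ := hz
  refine ⟨w, hi ?_⟩
  rw [map_smul, map_smul, hw, hx]
  simp [smul_sub]

theorem LoopExact.of_memAdd {T X : ModuleCat.{u} (TwoCycleOp k)} (hT : LoopExact k T)
    (h : MemAdd T X) : LoopExact k X := by
  obtain ⟨n, f, g, hfg⟩ := h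
  exact (hT.pi (ι := Fin n)).of_retract f g (LinearMap.congr_fun hfg)

theorem LoopExact.of_coresolvedBy {T : ModuleCat.{u} (TwoCycleOp k)} (hT : LoopExact k T)
    {X : ModuleCat.{u} (TwoCycleOp k)} {d : ℕ} (h : CoresolvedBy T X d) : LoopExact k X := by
  induction d generalizing X with
  | zero => exact hT.of_memAdd h
  | succ d ih =>
    obtain ⟨T₀, hT₀, f, hf, hC⟩ := h
    exact (hT.of_memAdd hT₀).of_injective f hf (ih hC)

end LoopExact

theorem loopExact_P₂ : LoopExact k (P₂ k) := by
  intro x h₁ h₂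
  have h₃ : x.fst = 0 := by simpa using congrArg Rep.fst h₁.symm
  have h₄ : x.snd.1 = 0 := by simpa using congrArg Rep.snd h₂
  exact ⟨⟨0, (x.snd.2, 0)⟩, by ext <;> simp [h₃, h₄]⟩

theorem loopExact_S₁ : LoopExact k (S₁ k) := by
  intro x h₁ h₂
  have h₃ : x.fst = 0 := by simpa using congrArg Rep.fst h₁.symm
  exact ⟨0, by ext; simp [h₃]⟩

theorem not_loopExact_P₁ : ¬ LoopExact k (P₁ k) := by
  intro h
  obtain ⟨y, hy⟩ := h ⟨0, 1⟩ (by ext <;> simp) (by ext <;> simp)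
  simpa using congrArg Rep.snd hy

theorem not_loopExact_S₂ : ¬ LoopExact k (S₂ k) := by
  intro h
  obtain ⟨y, hy⟩ := h ⟨0, 1⟩ (by ext; simp) (by ext; simp)
  simpa using congrArg Rep.snd hy

theorem not_loopExact_I₁ : ¬ LoopExact k (I₁ k) := by
  intro h
  obtain ⟨y, hy⟩ := h ⟨0, 1⟩ (by ext <;> simp) (by ext <;> simp)
  simpa using congrArg Rep.snd hy

theorem not_loopExact_regular : ¬ LoopExact k (TwoCycleOp k) := fun h =>
  not_loopExact_P₁ <| (h.of_equiv (regularEquiv k).symm).of_retract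
    (LinearMap.inl _ _ _) (LinearMap.fst _ _ (P₂ k)) fun _ => rfl

theorem isIndec_P₂ : IsIndec (ModuleCat.of (TwoCycleOp k) (P₂ k)) := by
  refine IsIndec.of_essential_element (X := ModuleCat.of (TwoCycleOp k) (P₂ k))
    (⟨0, (0, 1)⟩ : P₂ k) (fun h => by simpa using congrArg Rep.snd h) fun (x : P₂ k) hx => ?_
  by_cases h₁ : x.snd.1 = 0
  · by_cases h₂ : x.fst = 0
    · have h₃ : x.snd.2 ≠ 0 := fun h₃ => hx (by ext <;> simp [h₁, h₂, h₃])
      refine ⟨x.snd.2⁻¹ • e₂ k, (smul_assoc _ _ x).trans ?_⟩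
      ext <;> simp [h₁, h₃]
    · refine ⟨x.fst⁻¹ • a k, (smul_assoc _ _ x).trans ?_⟩
      ext <;> simp [h₂]
  · refine ⟨x.snd.1⁻¹ • (a k * b k), (smul_assoc _ _ x).trans ?_⟩
    ext <;> simp [h₁, mul_smul]

theorem isIndec_P₁ : IsIndec (ModuleCat.of (TwoCycleOp k) (P₁ k)) := by
  refine IsIndec.of_essential_element (X := ModuleCat.of (TwoCycleOp k) (P₁ k))
    (⟨0, 1⟩ : P₁ k) (fun h => by simpa using congrArg Rep.snd h) fun (x : P₁ k) hx => ?_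
  by_cases h₂ : x.fst = 0
  · have h₃ : x.snd ≠ 0 := fun h₃ => hx (by ext <;> simp [h₂, h₃])
    refine ⟨x.snd⁻¹ • e₂ k, (smul_assoc _ _ x).trans ?_⟩
    ext <;> simp [h₃]
  · refine ⟨x.fst⁻¹ • a k, (smul_assoc _ _ x).trans ?_⟩
    ext <;> simp [h₂]

theorem isIndec_I₁ : IsIndec (ModuleCat.of (TwoCycleOp k) (I₁ k)) := by
  refine IsIndec.of_essential_element (X := ModuleCat.of (TwoCycleOp k) (I₁ k))
    (⟨1, 0⟩ : I₁ k) (fun h => by simpa using congrArg Rep.fst h) fun (x : I₁ k) hx => ?_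
  by_cases h₂ : x.snd = 0
  · have h₃ : x.fst ≠ 0 := fun h₃ => hx (by ext <;> simp [h₂, h₃])
    refine ⟨x.fst⁻¹ • e₁ k, (smul_assoc _ _ x).trans ?_⟩
    ext <;> simp [h₃]
  · refine ⟨x.snd⁻¹ • b k, (smul_assoc _ _ x).trans ?_⟩
    ext <;> simp [h₂]

theorem isIndec_S₂ : IsIndec (ModuleCat.of (TwoCycleOp k) (S₂ k)) := by
  refine IsIndec.of_essential_element (X := ModuleCat.of (TwoCycleOp k) (S₂ k))
    (⟨0, 1⟩ : S₂ k) (fun h => by simpa using congrArg Rep.snd h) fun (x : S₂ k) hx => ?_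
  have h₃ : x.snd ≠ 0 := fun h₃ => hx (by ext; simp [h₃])
  refine ⟨x.snd⁻¹ • e₂ k, (smul_assoc _ _ x).trans ?_⟩
  ext; simp [h₃]

theorem a_smul_S₂ (x : S₂ k) : a k • x = 0 := by ext; simp
theorem b_smul_S₂ (x : S₂ k) : b k • x = 0 := by ext; simp
theorem b_smul_P₁ (x : P₁ k) : b k • x = 0 := by ext <;> simp

theorem exists_a_smul_P₁_ne_zero : ∃ x : P₁ k, a k • x ≠ 0 :=
  ⟨⟨1, 0⟩, fun h => by simpa using congrArg Rep.snd h⟩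

theorem exists_b_smul_I₁_ne_zero : ∃ x : I₁ k, b k • x ≠ 0 :=
  ⟨⟨0, 1⟩, fun h => by simpa using congrArg Rep.fst h⟩

theorem isEmpty_equiv_of_smul {X Y : Type*} [AddCommGroup X] [AddCommGroup Y]
    [Module (TwoCycleOp k) X] [Module (TwoCycleOp k) Y] (c : TwoCycleOp k)
    (hX : ∀ x : X, c • x = 0) (hY : ∃ y : Y, c • y ≠ 0) : IsEmpty (X ≃ₗ[TwoCycleOp k] Y) := by
  obtain ⟨y, hy⟩ := hY
  refine ⟨fun e => hy ?_⟩
  rw [← e.apply_symm_apply y, ← map_smul, hX, map_zero]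

theorem isEmpty_equiv_symm {X Y : Type*} [AddCommGroup X] [AddCommGroup Y]
    [Module (TwoCycleOp k) X] [Module (TwoCycleOp k) Y] (h : IsEmpty (X ≃ₗ[TwoCycleOp k] Y)) :
    IsEmpty (Y ≃ₗ[TwoCycleOp k] X) :=
  ⟨fun e => h.false e.symm⟩

/-- The classification of the indecomposable modules. -/
theorem equiv_of_isIndec (X : ModuleCat.{u} (TwoCycleOp k)) (hX : IsIndec X) :
    Nonempty (X ≃ₗ[TwoCycleOp k] P₂ k) ∨ Nonempty (X ≃ₗ[TwoCycleOp k] P₁ k) ∨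
    Nonempty (X ≃ₗ[TwoCycleOp k] I₁ k) ∨ Nonempty (X ≃ₗ[TwoCycleOp k] S₁ k) ∨
    Nonempty (X ≃ₗ[TwoCycleOp k] S₂ k) := by
  let := Module.restrictScalars k (TwoCycleOp k) X
  have : IsScalarTower k (TwoCycleOp k) X := IsScalarTower.restrictScalars _ _ _
  by_cases hab : ∃ y : X, a k • b k • y ≠ 0
  · obtain ⟨y, hy⟩ := hab
    obtain ⟨φ, hφ⟩ := Module.Projective.exists_dual_eq_one k hy
    have hinj : Function.Injective (fromP₂ (k := k) y) := by
      refine (injective_iff_map_eq_zero _).mpr fun w hw => ?_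
      have h := congrArg (toP₂ φ) hw
      rw [map_zero, fromP₂_apply] at h
      have h₁ := congrArg Rep.fst h
      have h₂ := congrArg Rep.snd h
      simp [mul_smul, hφ] at h₁ h₂
      have h₃ := h₂.2
      rw [h₂.1] at h₃
      ext
      · simp [h₁]
      · simp [h₂.1]
      · simpa using h₃
    obtain ⟨r, hr⟩ := injective_P₂.out (fromP₂ (k := k) y) hinj LinearMap.id
    have : Nontrivial (ModuleCat.of (TwoCycleOp k) (P₂ k)) := isIndec_P₂.1
    exact Or.inl (hX.nonempty_equiv_of_retract (N := ModuleCat.of (TwoCycleOp k) (P₂ k)) _ r hr)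
  push Not at hab
  by_cases ha : ∃ y : X, a k • y ≠ 0
  · obtain ⟨y, hy⟩ := ha
    obtain ⟨φ, hφ⟩ := Module.Projective.exists_dual_eq_one k hy
    have : Nontrivial (ModuleCat.of (TwoCycleOp k) (P₁ k)) := isIndec_P₁.1
    refine Or.inr (Or.inl (hX.nonempty_equiv_of_retract (N := ModuleCat.of (TwoCycleOp k) (P₁ k))
      (fromP₁ y) (toP₁ hab φ) fun (w : P₁ k) => ?_))
    ext <;> simp [fromP₁_apply, hφ]
  push Not at ha
  by_cases hb : ∃ y : X, b k • y ≠ 0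
  · obtain ⟨y, hy⟩ := hb
    obtain ⟨φ, hφ⟩ := Module.Projective.exists_dual_eq_one k hy
    have : Nontrivial (ModuleCat.of (TwoCycleOp k) (I₁ k)) := isIndec_I₁.1
    refine Or.inr (Or.inr (Or.inl (hX.nonempty_equiv_of_retract
      (N := ModuleCat.of (TwoCycleOp k) (I₁ k)) (fromI₁ y (ha _)) (toI₁ φ) fun (w : I₁ k) => ?_)))
    ext <;> simp [fromI₁_apply, hφ]
  push Not at hb
  by_cases h₁ : ∃ y : X, e₁ k • y ≠ 0
  · obtain ⟨y, hy⟩ := h₁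
    obtain ⟨φ, hφ⟩ := Module.Projective.exists_dual_eq_one k hy
    have : Nontrivial (ModuleCat.of (TwoCycleOp k) (S₁ k)) :=
      ⟨(⟨1, 0⟩ : S₁ k), 0, fun h => by simpa using congrArg Rep.fst h⟩
    refine Or.inr (Or.inr (Or.inr (Or.inl (hX.nonempty_equiv_of_retract
      (N := ModuleCat.of (TwoCycleOp k) (S₁ k)) (fromS₁ y (ha _)) (toS₁ hb φ)
      fun (w : S₁ k) => ?_))))
    ext
    simp [fromS₁_apply, hφ]
  push Not at h₁
  obtain ⟨y, hy⟩ := (nontrivial_iff_exists_ne (0 : X)).mp hX.1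
  rw [← e₁_smul_add_e₂_smul (k := k) y, h₁, zero_add] at hy
  obtain ⟨φ, hφ⟩ := Module.Projective.exists_dual_eq_one k hy
  have : Nontrivial (ModuleCat.of (TwoCycleOp k) (S₂ k)) := isIndec_S₂.1
  refine Or.inr (Or.inr (Or.inr (Or.inr (hX.nonempty_equiv_of_retract
    (N := ModuleCat.of (TwoCycleOp k) (S₂ k)) (fromS₂ y (hb _)) (toS₂ ha φ)
    fun (w : S₂ k) => ?_))))
  ext
  simp [fromS₂_apply, hφ]

section Sequences

variable (k)

/-- The inclusion of the radical of `P₂`. -/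
noncomputable def inclP₁ : P₁ k →ₗ[TwoCycleOp k] P₂ k :=
  Rep.map LinearMap.id (LinearMap.inr k k k) (by simp) (by simp)

/-- The projection of `P₂` onto its top. -/
noncomputable def projS₂ : P₂ k →ₗ[TwoCycleOp k] S₂ k :=
  Rep.map 0 (LinearMap.fst k k k) (by simp) (by simp)

/-- The inclusion of the socle of `P₂`. -/
noncomputable def inclS₂ : S₂ k →ₗ[TwoCycleOp k] P₂ k :=
  Rep.map 0 (LinearMap.inr k k k) (by simp) (by simp)

/-- The projection of `P₂` with kernel its socle. -/
noncomputable def projI₁ : P₂ k →ₗ[TwoCycleOp k] I₁ k :=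
  Rep.map LinearMap.id (LinearMap.fst k k k) (by simp) (by simp)

theorem inclP₁_injective : Function.Injective (inclP₁ k) := fun _ _ h =>
  Rep.ext (congrArg (fun x : P₂ k => x.fst) h) (congrArg (fun x : P₂ k => x.snd.2) h)

theorem inclS₂_injective : Function.Injective (inclS₂ k) := fun _ _ h =>
  Rep.ext rfl (congrArg (fun x : P₂ k => x.snd.2) h)

theorem projS₂_surjective : Function.Surjective (projS₂ k) := fun x =>
  ⟨⟨0, (x.snd, 0)⟩, rfl⟩

theorem projI₁_surjective : Function.Surjective (projI₁ k) := fun x =>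
  ⟨⟨x.fst, (x.snd, 0)⟩, rfl⟩

theorem exact_inclP₁_projS₂ : Function.Exact (inclP₁ k) (projS₂ k) := by
  refine fun y => ⟨fun h => ⟨⟨y.fst, y.snd.2⟩, ?_⟩, ?_⟩
  · have h₁ : y.snd.1 = 0 := congrArg Rep.snd h
    exact Rep.ext rfl (Prod.ext h₁.symm rfl)
  · rintro ⟨x, rfl⟩
    rfl

theorem exact_inclS₂_projI₁ : Function.Exact (inclS₂ k) (projI₁ k) := by
  refine fun y => ⟨fun h => ⟨⟨0, y.snd.2⟩, ?_⟩, ?_⟩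
  · have h₁ : y.fst = 0 := congrArg Rep.fst h
    have h₂ : y.snd.1 = 0 := congrArg Rep.snd h
    exact Rep.ext h₁.symm (Prod.ext h₂.symm rfl)
  · rintro ⟨x, rfl⟩
    rfl

end Sequences

theorem exact_inr_comp_prodMap_id {B X Y Z W : Type*} [Ring B] [AddCommGroup X] [AddCommGroup Y]
    [AddCommGroup Z] [AddCommGroup W] [Module B X] [Module B Y] [Module B Z] [Module B W]
    {i : X →ₗ[B] Y} {p : Y →ₗ[B] Z} (h : Function.Exact i p) :
    Function.Exact (LinearMap.inr B W Y ∘ₗ i) ((LinearMap.id : W →ₗ[B] W).prodMap p) := by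
  rintro ⟨w, y⟩
  constructor
  · intro hwy
    obtain ⟨x, rfl⟩ := (h y).mp (congrArg Prod.snd hwy)
    exact ⟨x, Prod.ext (congrArg Prod.fst hwy).symm rfl⟩
  · rintro ⟨x, hx⟩
    rw [← hx]
    exact Prod.ext rfl (h.apply_apply_eq_zero x)

theorem exact_prodMap_id_comp_fst {B X Y Z W : Type*} [Ring B] [AddCommGroup X] [AddCommGroup Y]
    [AddCommGroup Z] [AddCommGroup W] [Module B X] [Module B Y] [Module B Z] [Module B W]
    {i : X →ₗ[B] Y} {p : Y →ₗ[B] Z} (h : Function.Exact i p) :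
    Function.Exact (i.prodMap (LinearMap.id : W →ₗ[B] W)) (p ∘ₗ LinearMap.fst B Y W) := by
  rintro ⟨y, w⟩
  constructor
  · intro hy
    obtain ⟨x, rfl⟩ := (h y).mp hy
    exact ⟨(x, w), rfl⟩
  · rintro ⟨x, hx⟩
    rw [← hx]
    exact h.apply_apply_eq_zero x.1

theorem projDimLE_S₂ (K : ModuleCat.{u} (TwoCycleOp k))
    (e : Nonempty (S₂ k ≃ₗ[TwoCycleOp k] K)) : ProjDimLE K 1 :=
  ProjDimLE.of_exact projective_P₂ _ _ (inclP₁_injective k) (projS₂_surjective k)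
    (exact_inclP₁_projS₂ k) (ProjDimLE.of_projective projective_P₁) K e

theorem projective_P₂_prod_P₂ : Module.Projective (TwoCycleOp k) (P₂ k × P₂ k) :=
  have := projective_P₂ (k := k)
  inferInstance

theorem hasFiniteProjDim_P₂_prod_S₂ :
    HasFiniteProjDim (ModuleCat.of (TwoCycleOp k) (P₂ k × S₂ k)) :=
  ⟨1, ProjDimLE.of_exact (X := P₂ k × S₂ k) projective_P₂_prod_P₂
    (LinearMap.inr (TwoCycleOp k) (P₂ k) (P₂ k) ∘ₗ inclP₁ k) (LinearMap.id.prodMap (projS₂ k))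
    (LinearMap.inr_injective.comp (inclP₁_injective k))
    (Function.surjective_id.prodMap (projS₂_surjective k))
    (exact_inr_comp_prodMap_id (exact_inclP₁_projS₂ k))
    (ProjDimLE.of_projective projective_P₁) _ ⟨LinearEquiv.refl _ _⟩⟩

theorem hasFiniteProjDim_P₂_prod_I₁ :
    HasFiniteProjDim (ModuleCat.of (TwoCycleOp k) (P₂ k × I₁ k)) :=
  ⟨2, ProjDimLE.of_exact (X := P₂ k × I₁ k) projective_P₂_prod_P₂
    (LinearMap.inr (TwoCycleOp k) (P₂ k) (P₂ k) ∘ₗ inclS₂ k) (LinearMap.id.prodMap (projI₁ k))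
    (LinearMap.inr_injective.comp (inclS₂_injective k))
    (Function.surjective_id.prodMap (projI₁_surjective k))
    (exact_inr_comp_prodMap_id (exact_inclS₂_projI₁ k))
    projDimLE_S₂ _ ⟨LinearEquiv.refl _ _⟩⟩

theorem coresolvedBy_regular {T : ModuleCat.{u} (TwoCycleOp k)} {d : ℕ}
    (hP : MemAdd T (ModuleCat.of (TwoCycleOp k) (P₂ k)))
    (hS : ∀ C : ModuleCat.{u} (TwoCycleOp k),
      Nonempty (S₂ k ≃ₗ[TwoCycleOp k] C) → CoresolvedBy T C d) :
    CoresolvedBy T (ModuleCat.of (TwoCycleOp k) (TwoCycleOp k)) (d + 1) :=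
  CoresolvedBy.of_exact (hP.prod hP) _ _
    ((inclP₁_injective k).prodMap Function.injective_id)
    ((projS₂_surjective k).comp LinearMap.fst_surjective)
    (exact_prodMap_id_comp_fst (exact_inclP₁_projS₂ k)) hS _ ⟨regularEquiv k⟩

theorem hom_P₁_S₂_eq_zero (q : P₁ k →ₗ[TwoCycleOp k] S₂ k) : q = 0 := by
  ext x
  have hx : x = (x.fst • (1 : TwoCycleOp k) + x.snd • a k) • e₁ k • (⟨1, 0⟩ : P₁ k) := by
    ext <;> simp [add_smul]
  have h0 : e₁ k • q ⟨1, 0⟩ = 0 := by ext; simp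
  rw [hx, map_smul, map_smul, h0, smul_zero, LinearMap.zero_apply]

theorem selfOrthogonal_P₂_prod_S₂ :
    SelfOrthogonal (ModuleCat.of (TwoCycleOp k) (P₂ k × S₂ k)) := by
  refine SelfOrthogonal.of_exact (K := ModuleCat.of (TwoCycleOp k) (P₁ k))
    (P := ModuleCat.of (TwoCycleOp k) (P₂ k × P₂ k)) projective_P₁ projective_P₂_prod_P₂ _ _
    (LinearMap.inr_injective.comp (inclP₁_injective k))
    (Function.surjective_id.prodMap (projS₂_surjective k))
    (exact_inr_comp_prodMap_id (exact_inclP₁_projS₂ k))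
    fun (f : P₁ k →ₗ[TwoCycleOp k] P₂ k × S₂ k) => ?_
  obtain ⟨g, hg⟩ := injective_P₂.out (inclP₁ k) (inclP₁_injective k) (LinearMap.fst _ _ _ ∘ₗ f)
  refine ⟨LinearMap.inl _ _ _ ∘ₗ g ∘ₗ LinearMap.snd _ _ _, LinearMap.ext fun x => ?_⟩
  exact Prod.ext (hg x)
    (LinearMap.congr_fun (hom_P₁_S₂_eq_zero (LinearMap.snd _ _ _ ∘ₗ f)) x).symm

theorem memAdd_dSum_left {B : Type u} [Ring B] (M N : ModuleCat.{u} B) : MemAdd (dSum M N) M :=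
  MemAdd.of_retract (T := dSum M N) (LinearMap.inl B M N) (LinearMap.fst B M N) fun _ => rfl

theorem memAdd_dSum_right {B : Type u} [Ring B] (M N : ModuleCat.{u} B) : MemAdd (dSum M N) N :=
  MemAdd.of_retract (T := dSum M N) (LinearMap.inr B M N) (LinearMap.snd B M N) fun _ => rfl

theorem isTilting_P₂_P₁ : IsTilting
    (dSum (ModuleCat.of (TwoCycleOp k) (P₂ k)) (ModuleCat.of (TwoCycleOp k) (P₁ k))) := by
  have h : Module.Projective (TwoCycleOp k) (P₂ k × P₁ k) :=
    have := projective_P₁ (k := k)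
    have := projective_P₂ (k := k)
    inferInstance
  exact ⟨⟨0, h⟩, SelfOrthogonal.of_projective _ h, 0, CoresolvedBy.of_memAdd
    ((memAdd_dSum_right _ _).prod (memAdd_dSum_left _ _)) _ ⟨regularEquiv k⟩⟩

theorem isTilting_P₂_S₂ : IsTilting
    (dSum (ModuleCat.of (TwoCycleOp k) (P₂ k)) (ModuleCat.of (TwoCycleOp k) (S₂ k))) :=
  ⟨hasFiniteProjDim_P₂_prod_S₂, selfOrthogonal_P₂_prod_S₂, 1,
    coresolvedBy_regular (memAdd_dSum_left _ _) (CoresolvedBy.of_memAdd (memAdd_dSum_right _ _))⟩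

theorem isTilting_P₂_I₁ : IsTilting
    (dSum (ModuleCat.of (TwoCycleOp k) (P₂ k)) (ModuleCat.of (TwoCycleOp k) (I₁ k))) :=
  ⟨hasFiniteProjDim_P₂_prod_I₁,
    SelfOrthogonal.of_injective _ (Module.Injective.prod injective_P₂ injective_I₁), 2,
    coresolvedBy_regular (memAdd_dSum_left _ _) (CoresolvedBy.of_exact (memAdd_dSum_left _ _) _ _
      (inclS₂_injective k) (projI₁_surjective k) (exact_inclS₂_projI₁ k)
      (CoresolvedBy.of_memAdd (memAdd_dSum_right _ _)))⟩

theorem finite_of_finite (X : Type*) [AddCommGroup X] [Module k X] [Module (TwoCycleOp k) X]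
    [IsScalarTower k (TwoCycleOp k) X] [Module.Finite k X] : Module.Finite (TwoCycleOp k) X :=
  Module.Finite.of_restrictScalars_finite k _ _

theorem isComplement_P₁ : IsComplement (ModuleCat.of (TwoCycleOp k) (P₂ k))
    (ModuleCat.of (TwoCycleOp k) (P₁ k)) :=
  ⟨finite_of_finite (P₁ k), isIndec_P₁, fun h => not_loopExact_P₁ (loopExact_P₂.of_memAdd h),
    isTilting_P₂_P₁⟩

theorem isComplement_S₂ : IsComplement (ModuleCat.of (TwoCycleOp k) (P₂ k))
    (ModuleCat.of (TwoCycleOp k) (S₂ k)) :=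
  ⟨finite_of_finite (S₂ k), isIndec_S₂, fun h => not_loopExact_S₂ (loopExact_P₂.of_memAdd h),
    isTilting_P₂_S₂⟩

theorem isComplement_I₁ : IsComplement (ModuleCat.of (TwoCycleOp k) (P₂ k))
    (ModuleCat.of (TwoCycleOp k) (I₁ k)) :=
  ⟨finite_of_finite (I₁ k), isIndec_I₁, fun h => not_loopExact_I₁ (loopExact_P₂.of_memAdd h),
    isTilting_P₂_I₁⟩

theorem equiv_of_isComplement {X : ModuleCat.{u} (TwoCycleOp k)}
    (hX : IsComplement (ModuleCat.of (TwoCycleOp k) (P₂ k)) X) :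
    Nonempty (X ≃ₗ[TwoCycleOp k] P₁ k) ∨ Nonempty (X ≃ₗ[TwoCycleOp k] S₂ k) ∨
      Nonempty (X ≃ₗ[TwoCycleOp k] I₁ k) := by
  obtain ⟨-, hind, hadd, -, -, d, hd⟩ := hX
  rcases equiv_of_isIndec X hind with ⟨⟨e⟩⟩ | h | h | ⟨⟨e⟩⟩ | h
  · exact absurd (MemAdd.of_retract (T := ModuleCat.of (TwoCycleOp k) (P₂ k)) e.toLinearMap
      e.symm.toLinearMap e.symm_apply_apply) hadd
  · exact Or.inl h
  · exact Or.inr (Or.inr h)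
  · have hT : LoopExact k (dSum (ModuleCat.of (TwoCycleOp k) (P₂ k)) X) :=
      loopExact_P₂.prod (loopExact_S₁.of_equiv e.symm)
    exact absurd (hT.of_coresolvedBy hd) not_loopExact_regular
  · exact Or.inr (Or.inl h)

theorem hasRank_one {B : Type u} [Ring B] {M : ModuleCat.{u} B} (hM : IsIndec M) : HasRank M 1 :=
  ⟨fun _ => M, fun _ => hM, fun i j h => absurd (Subsingleton.elim i j) h,
    ⟨(LinearEquiv.funUnique (Fin 1) B M).symm⟩⟩

end TwoCycleOp

end Algebra

/-- There exist a gentle algebra of rank `2` and an almost-tilting module over it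
(an indecomposable pre-tilting module) having exactly `3` isomorphism classes of complements,
so the bound `2 * n - 1` is attained for `n = 2`. -/
theorem exists_rank_two_almost_tilting_with_three_complements
    (k : Type u) [Field k] [IsAlgClosed k] :
    ∃ Q : GentleQuiverData.{u},
      Fintype.card Q.V = 2 ∧ FiniteDimensional k (GentleAlg k Q) ∧
      ∃ M : ModuleCat.{u} (GentleAlg k Q)ᵐᵒᵖ,
        Module.Finite (GentleAlg k Q)ᵐᵒᵖ M ∧ IsPreTilting M ∧ HasRank M 1 ∧
        ∃ N : Fin 3 → ModuleCat.{u} (GentleAlg k Q)ᵐᵒᵖ,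
          (∀ i j, i ≠ j → IsEmpty (N i ≃ₗ[(GentleAlg k Q)ᵐᵒᵖ] N j)) ∧
          (∀ i, IsComplement M (N i)) ∧
          (∀ X : ModuleCat.{u} (GentleAlg k Q)ᵐᵒᵖ, IsComplement M X →
            ∃ i, Nonempty (X ≃ₗ[(GentleAlg k Q)ᵐᵒᵖ] N i)) := by
  refine ⟨twoCycle, by simp, TwoCycleOp.finiteDimensional_gentleAlg,
    ModuleCat.of _ (TwoCycleOp.P₂ k), TwoCycleOp.finite_of_finite (TwoCycleOp.P₂ k),
    ⟨⟨0, TwoCycleOp.projective_P₂⟩, SelfOrthogonal.of_projective _ TwoCycleOp.projective_P₂⟩,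
    TwoCycleOp.hasRank_one TwoCycleOp.isIndec_P₂,
    ![ModuleCat.of _ (TwoCycleOp.P₁ k), ModuleCat.of _ (TwoCycleOp.S₂ k),
      ModuleCat.of _ (TwoCycleOp.I₁ k)], ?_, ?_, ?_⟩
  · have h₁ : IsEmpty (TwoCycleOp.S₂ k ≃ₗ[TwoCycleOp k] TwoCycleOp.P₁ k) :=
      TwoCycleOp.isEmpty_equiv_of_smul _ TwoCycleOp.a_smul_S₂ TwoCycleOp.exists_a_smul_P₁_ne_zero
    have h₂ : IsEmpty (TwoCycleOp.S₂ k ≃ₗ[TwoCycleOp k] TwoCycleOp.I₁ k) :=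
      TwoCycleOp.isEmpty_equiv_of_smul _ TwoCycleOp.b_smul_S₂ TwoCycleOp.exists_b_smul_I₁_ne_zero
    have h₃ : IsEmpty (TwoCycleOp.P₁ k ≃ₗ[TwoCycleOp k] TwoCycleOp.I₁ k) :=
      TwoCycleOp.isEmpty_equiv_of_smul _ TwoCycleOp.b_smul_P₁ TwoCycleOp.exists_b_smul_I₁_ne_zero
    intro i j hij
    fin_cases i <;> fin_cases j
    · exact absurd rfl hij
    · exact TwoCycleOp.isEmpty_equiv_symm h₁
    · exact h₃
    · exact h₁
    · exact absurd rfl hij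
    · exact h₂
    · exact TwoCycleOp.isEmpty_equiv_symm h₃
    · exact TwoCycleOp.isEmpty_equiv_symm h₂
    · exact absurd rfl hij
  · intro i
    fin_cases i
    · exact TwoCycleOp.isComplement_P₁
    · exact TwoCycleOp.isComplement_S₂
    · exact TwoCycleOp.isComplement_I₁
  · intro X hX
    rcases TwoCycleOp.equiv_of_isComplement hX with h | h | h
    · exact ⟨0, h⟩
    · exact ⟨1, h⟩
    · exact ⟨2, h⟩
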